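/- arXiv:2105.12534 — 2 statements merged into one kernel-verified Lean document; each statement's English description precedes it below -/
import Mathlib

section
/- Let R be a self-full equivalence relation on ℕ, let k ≥ 1, and let S be an equivalence relation on ℕ with R ≤c S and S ≤c R ⊕ Id_k. Then either S ≡c R or there is j with 1 ≤ j ≤ k such that S ≡c R ⊕ Id_j. -/
/-- A computable reduction of `R` to `S`: a total computable function `f` with
`R x y ↔ S (f x) (f y)`.  `CompRed R S` means such a reduction exists (`R ≤c S`). -/
def CompRed (R S : ℕ → ℕ → Prop) : Prop :=
  ∃ f : ℕ → ℕ, Computable f ∧ ∀ x y, R x y ↔ S (f x) (f y)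

/-- `R ≡c S`. -/
def EquivC (R S : ℕ → ℕ → Prop) : Prop := CompRed R S ∧ CompRed S R

/-- `R <c S`. -/
def StrictRed (R S : ℕ → ℕ → Prop) : Prop := CompRed R S ∧ ¬ CompRed S R

/-- The identity equivalence relation `Id` on ℕ. -/
def IdEq : ℕ → ℕ → Prop := fun x y => x = y

/-- `Id_n` : congruence modulo `n` on ℕ. -/
def IdN (n : ℕ) : ℕ → ℕ → Prop := fun x y => x % n = y % n

/-- The uniform join `R ⊕ S`. -/
def Join (R S : ℕ → ℕ → Prop) : ℕ → ℕ → Prop := fun a b =>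
  (∃ x y, a = 2 * x ∧ b = 2 * y ∧ R x y) ∨
  (∃ x y, a = 2 * x + 1 ∧ b = 2 * y + 1 ∧ S x y)

/-- The set of equivalence classes of `R`. -/
def classes (R : ℕ → ℕ → Prop) : Set (Set ℕ) := {C | ∃ a, C = {z | R z a}}

/-- `R` is dark: infinitely many classes and `Id` does not reduce to `R`. -/
def Dark (R : ℕ → ℕ → Prop) : Prop := (classes R).Infinite ∧ ¬ CompRed IdEq R

/-- `R` is dark minimal: dark, and everything strictly below has finitely many classes. -/
def DarkMinimal (R : ℕ → ℕ → Prop) : Prop :=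
  Dark R ∧ ∀ S : ℕ → ℕ → Prop, Equivalence S → StrictRed S R → (classes S).Finite

/-- `T` is a least upper bound of `R` and `S` in the computable-reducibility order. -/
def IsLub' (R S T : ℕ → ℕ → Prop) : Prop :=
  CompRed R T ∧ CompRed S T ∧
    ∀ U : ℕ → ℕ → Prop, Equivalence U → CompRed R U → CompRed S U → CompRed T U

/-- `W` is computably enumerable. -/
def CE (W : Set ℕ) : Prop := W = ∅ ∨ ∃ f : ℕ → ℕ, Computable f ∧ W = Set.range f

/-- `R ≤_F S`: `R` restricted to a decidable set `A` computably reduces to `S`,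
and `R` restricted to the complement of `A` has finitely many classes. -/
def FRed (R S : ℕ → ℕ → Prop) : Prop :=
  ∃ A : Set ℕ, ComputablePred (· ∈ A) ∧
    (∃ f : ℕ → ℕ, Computable f ∧ ∀ x ∈ A, ∀ y ∈ A, (R x y ↔ S (f x) (f y))) ∧
    {C : Set ℕ | ∃ a ∉ A, C = {z | z ∉ A ∧ R z a}}.Finite

/-- `U` is a pure quotient of `R ⊕ S`. -/
def PureQuotient (R S U : ℕ → ℕ → Prop) : Prop :=
  (∀ a b, Join R S a b → U a b) ∧
  (∀ x y, U (2 * x) (2 * y) ↔ R x y) ∧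
  (∀ x y, U (2 * x + 1) (2 * y + 1) ↔ S x y)

/-- `R` is noncomputably avoiding: for every finite set of representatives of
noncomputable `R`-classes, some self-reduction of `R` avoids all those classes. -/
def NCA (R : ℕ → ℕ → Prop) : Prop :=
  ∀ F : Finset ℕ, (∀ a ∈ F, ¬ ComputablePred fun z => R z a) →
    ∃ g : ℕ → ℕ, Computable g ∧ (∀ x y, R x y ↔ R (g x) (g y)) ∧
      ∀ a ∈ F, ∀ x, ¬ R (g x) a

/-- `R` is self-full: every computable self-reduction of `R` hits every `R`-class. -/
def SelfFull (R : ℕ → ℕ → Prop) : Prop :=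
  ∀ f : ℕ → ℕ, Computable f → (∀ x y, R x y ↔ R (f x) (f y)) → ∀ y, ∃ x, R (f x) y

/-- `T` is a strong minimal cover of `R`. -/
def StrongMinCover (R T : ℕ → ℕ → Prop) : Prop :=
  StrictRed R T ∧ ∀ X : ℕ → ℕ → Prop, Equivalence X → StrictRed X T → CompRed X R

theorem join_even_even {R S : ℕ → ℕ → Prop} {x y : ℕ} :
    Join R S (2 * x) (2 * y) ↔ R x y := by
  constructor
  · rintro (⟨a, b, h, h', r⟩ | ⟨a, b, h, h', r⟩)
    · obtain rfl : x = a := by omega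
      obtain rfl : y = b := by omega
      exact r
    · omega
  · exact fun h => Or.inl ⟨x, y, rfl, rfl, h⟩

theorem join_odd_odd {R S : ℕ → ℕ → Prop} {x y : ℕ} :
    Join R S (2 * x + 1) (2 * y + 1) ↔ S x y := by
  constructor
  · rintro (⟨a, b, h, h', r⟩ | ⟨a, b, h, h', r⟩)
    · omega
    · obtain rfl : x = a := by omega
      obtain rfl : y = b := by omega
      exact r
  · exact fun h => Or.inr ⟨x, y, rfl, rfl, h⟩

theorem not_join_even_odd {R S : ℕ → ℕ → Prop} {x y : ℕ} :
    ¬ Join R S (2 * x) (2 * y + 1) := by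
  rintro (⟨a, b, h, h', r⟩ | ⟨a, b, h, h', r⟩) <;> omega

theorem not_join_odd_even {R S : ℕ → ℕ → Prop} {x y : ℕ} :
    ¬ Join R S (2 * x + 1) (2 * y) := by
  rintro (⟨a, b, h, h', r⟩ | ⟨a, b, h, h', r⟩) <;> omega

theorem equivalence_join {R S : ℕ → ℕ → Prop} (hR : Equivalence R) (hS : Equivalence S) :
    Equivalence (Join R S) where
  refl x := by
    obtain ⟨a, rfl | rfl⟩ := x.even_or_odd'
    · exact join_even_even.2 (hR.refl a)
    · exact join_odd_odd.2 (hS.refl a)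
  symm := by
    rintro x y (⟨a, b, rfl, rfl, h⟩ | ⟨a, b, rfl, rfl, h⟩)
    · exact join_even_even.2 (hR.symm h)
    · exact join_odd_odd.2 (hS.symm h)
  trans := by
    rintro x y z (⟨a, b, rfl, rfl, h⟩ | ⟨a, b, rfl, rfl, h⟩) h'
    · obtain ⟨c, rfl | rfl⟩ := z.even_or_odd'
      · exact join_even_even.2 (hR.trans h (join_even_even.1 h'))
      · exact (not_join_even_odd h').elim
    · obtain ⟨c, rfl | rfl⟩ := z.even_or_odd'
      · exact (not_join_odd_even h').elim
      · exact join_odd_odd.2 (hS.trans h (join_odd_odd.1 h'))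

theorem computable_nat_find {α : Type*} [Primcodable α] {p : α → ℕ → Bool} (hp : Computable₂ p)
    (h : ∀ a, ∃ n, p a n = true) : Computable fun a => Nat.find (h a) :=
  Computable.find (P := fun a n => p a n = true) (ComputablePred.computable_iff.2 ⟨_, hp, rfl⟩) h

/-- `p x` holds for all `x < n`, as a Boolean recursion. -/
def boundedAll (p : ℕ → Bool) (n : ℕ) : Bool :=
  Nat.rec true (fun x b => b && p x) n

theorem boundedAll_eq_true {p : ℕ → Bool} {n : ℕ} :
    boundedAll p n = true ↔ ∀ x < n, p x = true := by
  induction n with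
  | zero => simp [boundedAll]
  | succ n ih =>
    change (boundedAll p n && p n) = true ↔ _
    rw [Bool.and_eq_true, ih]
    exact Nat.forall_lt_succ_right.symm

theorem computable_boundedAll {α : Type*} [Primcodable α] {p : α → ℕ → Bool} {f : α → ℕ}
    (hp : Computable₂ p) (hf : Computable f) : Computable fun a => boundedAll (p a) (f a) := by
  refine Computable.nat_rec (h := fun a q => q.2 && p a q.1) hf (Computable.const true) ?_
  exact Primrec.and.to_comp.comp (Computable.snd.comp Computable.snd)
    (hp.comp Computable.fst (Computable.fst.comp Computable.snd))

/-- A self-full relation has no uniformly decidable infinite sequence of distinct classes. -/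
theorem SelfFull.false_of_decidable_classes {R : ℕ → ℕ → Prop} (hR : Equivalence R)
    (hsf : SelfFull R) {D : ℕ → ℕ → Bool} (hD : Computable₂ D)
    (hcl : ∀ i x y, D i x = true → (R x y ↔ D i y = true))
    (hdisj : ∀ i j x, D i x = true → D j x = true → i = j) (hne : ∀ i, ∃ x, D i x = true) :
    False := by
  have hm : ∀ i, ∃ m, boundedAll (fun x => !D (Nat.pair i m) x) (i + 1) = true := by
    intro i
    by_contra! H
    have H' : ∀ m, ∃ x : Fin (i + 1), D (Nat.pair i m) x = true := by
      intro m
      have := H m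
      rw [Ne, boundedAll_eq_true] at this
      push Not at this
      obtain ⟨x, hx, hx'⟩ := this
      exact ⟨⟨x, hx⟩, by simpa using hx'⟩
    choose x hx using H'
    refine not_injective_infinite_finite x fun m m' h => ?_
    have := hdisj _ _ _ (hx m) (h ▸ hx m')
    exact (Nat.pair_eq_pair.1 this).2
  have hm_comp : Computable fun i => Nat.find (hm i) := by
    refine computable_nat_find (p := fun i m =>
      boundedAll (fun x => !D (Nat.pair i m) x) (i + 1)) ?_ hm
    refine computable_boundedAll (α := ℕ × ℕ) (p := fun a x => !D (Nat.pair a.1 a.2) x) ?_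
      (Computable.succ.comp Computable.fst)
    exact Primrec.not.to_comp.comp (hD.comp (Primrec₂.natPair.to_comp.comp
      (Computable.fst.comp Computable.fst) (Computable.snd.comp Computable.fst)) Computable.snd)
  obtain ⟨C, hC, hC_cl, hC_disj, hC_ne, hC_lt⟩ : ∃ C : ℕ → ℕ → Bool, Computable₂ C ∧
      (∀ i x y, C i x = true → (R x y ↔ C i y = true)) ∧
      (∀ i j x, C i x = true → C j x = true → i = j) ∧ (∀ i, ∃ x, C i x = true) ∧
      ∀ i x, C i x = true → i < x := by
    refine ⟨fun i => D (Nat.pair i (Nat.find (hm i))), ?_, fun i => hcl _, fun i j x h h' =>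
      (Nat.pair_eq_pair.1 (hdisj _ _ _ h h')).1, fun i => hne _, fun i x h => ?_⟩
    · exact hD.comp (Primrec₂.natPair.to_comp.comp Computable.fst
        (hm_comp.comp Computable.fst)) Computable.snd
    · by_contra! hx
      have := boundedAll_eq_true.1 (Nat.find_spec (hm i)) x (by omega)
      simp [h] at this
  let r : ℕ → ℕ := fun i => Nat.find (hC_ne i)
  have hr : ∀ i, C i (r i) = true := fun i => Nat.find_spec (hC_ne i)
  have hr_comp : Computable r := computable_nat_find hC hC_ne
  let G : ℕ → ℕ → ℕ := fun x n => Nat.rec x (fun i y => bif C i x then r (i + 1) else y) n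
  have hG : ∀ x n, (∃ i < n, C i x = true ∧ G x n = r (i + 1)) ∨
      ((∀ i < n, C i x = false) ∧ G x n = x) := by
    intro x n
    induction n with
    | zero => exact Or.inr ⟨by simp, rfl⟩
    | succ n ih =>
      have hs : G x (n + 1) = bif C n x then r (n + 1) else G x n := rfl
      cases hc : C n x with
      | true => exact Or.inl ⟨n, by omega, hc, by simp [hs, hc]⟩
      | false =>
        rw [hc, cond_false] at hs
        rw [hs]
        rcases ih with ⟨i, hi, h⟩ | ⟨h, h'⟩
        · exact Or.inl ⟨i, by omega, h⟩
        · exact Or.inr ⟨Nat.forall_lt_succ_right.2 ⟨h, hc⟩, h'⟩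
  have hF : ∀ x, (∃ i, C i x = true ∧ G x x = r (i + 1)) ∨
      ((∀ i, C i x ≠ true) ∧ G x x = x) := by
    intro x
    rcases hG x x with ⟨i, -, h⟩ | ⟨h, h'⟩
    · exact Or.inl ⟨i, h⟩
    · refine Or.inr ⟨fun i hi => ?_, h'⟩
      have := h i (hC_lt i x hi)
      simp [hi] at this
  have hF_comp : Computable fun x => G x x := by
    refine Computable.nat_rec (f := fun x : ℕ => x) (g := fun x : ℕ => x)
      (h := fun x q => bif C q.1 x then r (q.1 + 1) else q.2) Computable.id Computable.id ?_
    have h1 : Computable fun q : ℕ × ℕ × ℕ => q.2.1 := Computable.fst.comp Computable.snd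
    exact Computable.cond (hC.comp h1 Computable.fst)
      (hr_comp.comp (Computable.succ.comp h1)) (Computable.snd.comp Computable.snd)
  obtain ⟨x, hx⟩ := hsf (fun x => G x x) hF_comp (fun x y => by
    rcases hF x with ⟨i, hi, e⟩ | ⟨hi, e⟩ <;> rcases hF y with ⟨j, hj, e'⟩ | ⟨hj, e'⟩ <;>
      simp only [e, e']
    · rw [hC_cl i x y hi, hC_cl (i + 1) _ _ (hr (i + 1))]
      constructor
      · intro h
        obtain rfl := hC_disj _ _ _ h hj
        exact hr _
      · intro h
        have := hC_disj _ _ _ h (hr (j + 1))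
        obtain rfl : i = j := by omega
        exact hj
    · rw [hC_cl i x y hi, hC_cl (i + 1) _ _ (hr (i + 1))]
      exact ⟨fun h => (hj _ h).elim, fun h => (hj _ h).elim⟩
    · refine ⟨fun h => (hi j ?_).elim, fun h => (hi (j + 1) ?_).elim⟩
      · exact (hC_cl j y x hj).1 (hR.symm h)
      · exact (hC_cl (j + 1) _ x (hr _)).1 (hR.symm h)) (r 0)
  have h0 : C 0 (G x x) = true := (hC_cl 0 _ _ (hr 0)).1 (hR.symm hx)
  rcases hF x with ⟨i, hi, e⟩ | ⟨hi, e⟩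
  · rw [e] at h0
    exact absurd (hC_disj _ _ _ h0 (hr (i + 1))) (by omega)
  · rw [e] at h0
    exact hi 0 h0

/-- `ExitsAt h s i y`: iterating the partial map `2 * x ↦ h x`, undefined on odd numbers, from `y`
stops after exactly `i` steps, at `2 * s + 1`. -/
def ExitsAt (h : ℕ → ℕ) (s : ℕ) : ℕ → ℕ → Prop
  | 0, y => y = 2 * s + 1
  | i + 1, y => ∃ x, y = 2 * x ∧ ExitsAt h s i (h x)

theorem exitsAt_succ {h : ℕ → ℕ} {s i x : ℕ} :
    ExitsAt h s (i + 1) (2 * x) ↔ ExitsAt h s i (h x) := by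
  constructor
  · rintro ⟨x', e, hx⟩
    obtain rfl : x = x' := by omega
    exact hx
  · exact fun hx => ⟨x, rfl, hx⟩

theorem ExitsAt.congr {R : ℕ → ℕ → Prop} {h : ℕ → ℕ}
    (hh : ∀ x y, R x y ↔ Join R IdEq (h x) (h y)) {s i : ℕ} :
    ∀ {y y'}, Join R IdEq y y' → ExitsAt h s i y → ExitsAt h s i y' := by
  induction i with
  | zero =>
    rintro y y' hJ rfl
    obtain ⟨x, rfl | rfl⟩ := y'.even_or_odd'
    · exact (not_join_odd_even hJ).elim
    · have : s = x := join_odd_odd.1 hJ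
      rw [this]; rfl
  | succ i ih =>
    rintro y y' hJ ⟨x, rfl, hx⟩
    obtain ⟨x', rfl | rfl⟩ := y'.even_or_odd'
    · exact exitsAt_succ.2 (ih ((hh _ _).1 (join_even_even.1 hJ)) hx)
    · exact (not_join_even_odd hJ).elim

theorem ExitsAt.join {R : ℕ → ℕ → Prop} {h : ℕ → ℕ}
    (hh : ∀ x y, R x y ↔ Join R IdEq (h x) (h y)) {s i : ℕ} :
    ∀ {y y'}, ExitsAt h s i y → ExitsAt h s i y' → Join R IdEq y y' := by
  induction i with
  | zero =>
    rintro y y' rfl rfl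
    exact join_odd_odd.2 rfl
  | succ i ih =>
    rintro y y' ⟨x, rfl, hx⟩ ⟨x', rfl, hx'⟩
    exact join_even_even.2 ((hh _ _).2 (ih hx hx'))

theorem ExitsAt.unique {h : ℕ → ℕ} {s s' i : ℕ} :
    ∀ {i' y}, ExitsAt h s i y → ExitsAt h s' i' y → s = s' ∧ i = i' := by
  induction i with
  | zero =>
    rintro i' y rfl h'
    cases i' with
    | zero => exact ⟨by have : 2 * s + 1 = 2 * s' + 1 := h'; omega, rfl⟩
    | succ i' =>
      obtain ⟨x, e, -⟩ := h'
      omega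
  | succ i ih =>
    rintro i' y ⟨x, rfl, hx⟩ h'
    cases i' with
    | zero =>
      have : 2 * x = 2 * s' + 1 := h'
      omega
    | succ i' =>
      obtain ⟨rfl, rfl⟩ := ih hx (exitsAt_succ.1 h')
      exact ⟨rfl, rfl⟩

theorem exists_computable_exitsAt {h : ℕ → ℕ} (hc : Computable h) (s : ℕ) :
    ∃ D : ℕ → ℕ → Bool, Computable₂ D ∧ ∀ i y, D i y = true ↔ ExitsAt h s i y := by
  let H : ℕ → ℕ × Bool → ℕ × Bool := fun _ q =>
    (h q.1.div2, q.2 && !q.1.bodd)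
  let O : ℕ → ℕ → ℕ × Bool := fun y i => Nat.rec (y, true) H i
  have hO : Computable₂ O := by
    refine Computable.nat_rec (f := fun a : ℕ × ℕ => a.2) (g := fun a : ℕ × ℕ => (a.1, true))
      (h := fun _ q => H q.1 q.2) Computable.snd
      (Computable.pair Computable.fst (Computable.const true)) ?_
    have h2 : Computable fun q : (ℕ × ℕ) × ℕ × ℕ × Bool => q.2.2 :=
      Computable.snd.comp Computable.snd
    have h3 := Computable.fst.comp h2
    exact Computable.pair (hc.comp (Computable.nat_div2.comp h3))
      (Primrec.and.to_comp.comp (Computable.snd.comp h2)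
        (Primrec.not.to_comp.comp (Computable.nat_bodd.comp h3)))
  have hO_odd : ∀ y i, y.bodd = true → (O y (i + 1)).2 = false := by
    intro y i hy
    induction i with
    | zero => simp [O, H, hy]
    | succ i ih =>
      change ((O y (i + 1)).2 && _) = false
      rw [ih]; rfl
  have hO_even : ∀ x i, O (2 * x) (i + 1) = O (h x) i := by
    intro x i
    induction i with
    | zero => simp [O, H]
    | succ i ih =>
      change H (i + 1) (O (2 * x) (i + 1)) = H i (O (h x) i)
      rw [ih]
  refine ⟨fun i y => (O y i).2 && ((O y i).1 == 2 * s + 1), ?_, fun i => ?_⟩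
  · have h1 : Computable fun a : ℕ × ℕ => O a.2 a.1 := hO.comp Computable.snd Computable.fst
    exact Primrec.and.to_comp.comp (Computable.snd.comp h1)
      (Primrec.beq.to_comp.comp (Computable.fst.comp h1) (Computable.const _))
  · induction i with
    | zero => intro y; simp [O, ExitsAt]
    | succ i ih =>
      intro y
      obtain ⟨x, rfl | rfl⟩ := y.even_or_odd'
      · rw [exitsAt_succ, ← ih]
        simp only [hO_even]
      · simp only [hO_odd _ _ (show (2 * x + 1).bodd = true by simp), Bool.false_and, Bool.false_eq_true, false_iff]
        rintro ⟨x', e, -⟩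
        omega

/-- Every backward orbit of an odd class under a reduction of a self-full `R` to `R ⊕ Id` ends in a
class outside the range. -/
theorem SelfFull.exists_exitsAt_not_mem_range {R : ℕ → ℕ → Prop} (hR : Equivalence R)
    (hsf : SelfFull R) {h : ℕ → ℕ} (hc : Computable h)
    (hh : ∀ x y, R x y ↔ Join R IdEq (h x) (h y)) (s : ℕ) :
    ∃ i y, ExitsAt h s i y ∧ ∀ x, ¬ Join R IdEq (h x) y := by
  have hJ : Equivalence (Join R IdEq) := equivalence_join hR eq_equivalence
  have hfin : ∃ i, ∀ x, ¬ ExitsAt h s (i + 1) (2 * x) := by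
    by_contra! H
    obtain ⟨D, hD, hDE⟩ := exists_computable_exitsAt hc s
    refine hsf.false_of_decidable_classes hR (D := fun i x => D (i + 1) (2 * x)) ?_ ?_ ?_ ?_
    · exact hD.comp (Computable.succ.comp Computable.fst)
        (Primrec.nat_double.to_comp.comp Computable.snd)
    · simp only [hDE]
      exact fun i x y hx => ⟨fun h' => hx.congr hh (join_even_even.2 h'),
        fun hy => join_even_even.1 (hx.join hh hy)⟩
    · simp only [hDE]
      exact fun i j x hx hx' => Nat.succ_injective (hx.unique hx').2
    · simpa only [hDE] using H
  classical
  obtain ⟨y, hy⟩ : ∃ y, ExitsAt h s (Nat.find hfin) y := by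
    cases hi : Nat.find hfin with
    | zero => exact ⟨2 * s + 1, rfl⟩
    | succ i =>
      have := Nat.find_min hfin (m := i) (by omega)
      push Not at this
      exact ⟨_, this.choose_spec⟩
  exact ⟨_, y, hy, fun x hx =>
    Nat.find_spec hfin x (exitsAt_succ.2 (hy.congr hh (hJ.symm hx)))⟩

/-- `S` reduces to `R ⊕ Id` with all odd values among the first `j` odd numbers. -/
def RedBelow (S R : ℕ → ℕ → Prop) (j : ℕ) : Prop :=
  ∃ g : ℕ → ℕ, Computable g ∧ (∀ x y, S x y ↔ Join R IdEq (g x) (g y)) ∧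
    ∀ x z, g x = 2 * z + 1 → z < j

theorem computable_parity_cases {f g : ℕ → ℕ} (hf : Computable f) (hg : Computable g) :
    Computable fun x : ℕ => bif x.bodd then g x.div2 else f x.div2 :=
  Computable.cond Computable.nat_bodd (hg.comp Computable.nat_div2) (hf.comp Computable.nat_div2)

theorem redBelow_of_compRed {R S : ℕ → ℕ → Prop} {k : ℕ} (hk : 1 ≤ k)
    (h : CompRed S (Join R (IdN k))) : RedBelow S R k := by
  obtain ⟨g, hg, hgr⟩ := h
  let m : ℕ → ℕ := fun x : ℕ => bif x.bodd then 2 * (x.div2 % k) + 1 else 2 * x.div2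
  have hm0 : ∀ a, m (2 * a) = 2 * a := fun a => by simp [m]
  have hm1 : ∀ a, m (2 * a + 1) = 2 * (a % k) + 1 := fun a => by simp [m]
  refine ⟨fun x => m (g x), ?_, fun x y => ?_, fun x z => ?_⟩
  · refine Computable.comp ?_ hg
    exact computable_parity_cases (f := fun x => 2 * x) (g := fun x => 2 * (x % k) + 1)
      Primrec.nat_double.to_comp
      (Primrec.nat_double_succ.to_comp.comp
        (Primrec.nat_mod.to_comp.comp Computable.id (Computable.const k)))
  · rw [hgr]
    obtain ⟨a, ha | ha⟩ := (g x).even_or_odd' <;> obtain ⟨b, hb | hb⟩ := (g y).even_or_odd' <;>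
      simp only [ha, hb, hm0, hm1, join_even_even, join_odd_odd, not_join_even_odd,
        not_join_odd_even, IdN, IdEq]
  · obtain ⟨a, ha | ha⟩ := (g x).even_or_odd' <;> simp only [ha, hm0, hm1]
    · omega
    · have := Nat.mod_lt a hk
      omega

theorem compRed_of_redBelow_zero {R S : ℕ → ℕ → Prop} (h : RedBelow S R 0) : CompRed S R := by
  obtain ⟨g, hg, hgr, hb⟩ := h
  refine ⟨fun x => (g x).div2, Computable.nat_div2.comp hg, fun x y => ?_⟩
  have he : ∀ x, g x = 2 * (g x).div2 := by
    intro x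
    obtain ⟨a, ha | ha⟩ := (g x).even_or_odd'
    · rw [ha]; simp
    · exact absurd (hb x a ha) (by omega)
  rw [hgr, he x, he y, join_even_even]

theorem compRed_of_redBelow {R S : ℕ → ℕ → Prop} {j : ℕ} (h : RedBelow S R j) :
    CompRed S (Join R (IdN j)) := by
  obtain ⟨g, hg, hgr, hb⟩ := h
  refine ⟨g, hg, fun x y => ?_⟩
  rw [hgr]
  obtain ⟨a, ha | ha⟩ := (g x).even_or_odd' <;> obtain ⟨b, hb' | hb'⟩ := (g y).even_or_odd' <;>
    simp only [ha, hb', join_even_even, join_odd_odd, not_join_even_odd, not_join_odd_even,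
      IdN, IdEq]
  rw [Nat.mod_eq_of_lt (hb x a ha), Nat.mod_eq_of_lt (hb y b hb')]

/-- If a reduction into `R ⊕ Id_(j+1)` misses a class, then one odd class can be freed. -/
theorem redBelow_of_not_mem_range {R S : ℕ → ℕ → Prop} (hR : Equivalence R) {j : ℕ} {g : ℕ → ℕ}
    (hg : Computable g) (hgr : ∀ x y, S x y ↔ Join R IdEq (g x) (g y))
    (hb : ∀ x z, g x = 2 * z + 1 → z < j + 1) {e : ℕ} (he : ∀ z, e = 2 * z + 1 → z < j + 1)
    (hmiss : ∀ x, ¬ Join R IdEq (g x) e) : RedBelow S R j := by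
  have hJ : Equivalence (Join R IdEq) := equivalence_join hR eq_equivalence
  have hstar : ∀ {y}, Join R IdEq y (2 * j + 1) ↔ y = 2 * j + 1 := by
    intro y
    obtain ⟨a, rfl | rfl⟩ := y.even_or_odd'
    · simp only [not_join_even_odd, false_iff]; omega
    · rw [join_odd_odd, IdEq]; omega
  refine ⟨fun x => bif g x == 2 * j + 1 then e else g x, ?_, fun x y => ?_, fun x z => ?_⟩
  · exact Computable.cond (Primrec.beq.to_comp.comp hg (Computable.const _))
      (Computable.const e) hg
  · rw [hgr]
    by_cases hx : g x = 2 * j + 1 <;> by_cases hy : g y = 2 * j + 1 <;>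
      simp only [hx, hy, beq_self_eq_true, cond_true, beq_eq_false_iff_ne.2, cond_false, ne_eq,
        not_false_eq_true]
    · exact ⟨fun _ => hJ.refl _, fun _ => hJ.refl _⟩
    · exact ⟨fun h => (hy (hstar.1 (hJ.symm h))).elim, fun h => (hmiss y (hJ.symm h)).elim⟩
    · exact ⟨fun h => (hx (hstar.1 h)).elim, fun h => (hmiss x h).elim⟩
  · have hej : ∀ x, g x = 2 * j + 1 → e ≠ 2 * j + 1 := by
      rintro x hx rfl
      exact hmiss x (hstar.2 hx)
    by_cases hx : g x = 2 * j + 1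
    · simp only [hx, beq_self_eq_true, cond_true]
      intro h
      have := he z h
      have := hej x hx
      omega
    · simp only [beq_eq_false_iff_ne.2 hx, cond_false]
      intro h
      have := hb x z h
      omega

theorem exists_computable_eq_of_lt (c : ℕ → ℕ) (j : ℕ) :
    ∃ c' : ℕ → ℕ, Computable c' ∧ ∀ n < j, c' n = c n := by
  induction j with
  | zero => exact ⟨id, Computable.id, by simp⟩
  | succ j ih =>
    obtain ⟨c', hc', h⟩ := ih
    refine ⟨fun n => bif n == j then c j else c' n, Computable.cond
      (Primrec.beq.to_comp.comp Computable.id (Computable.const _)) (Computable.const _) hc',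
      fun n hn => ?_⟩
    by_cases hnj : n = j
    · simp [hnj]
    · simp only [beq_eq_false_iff_ne.2 hnj, cond_false]
      exact h n (by omega)

/-- A reduction of `R` to `S` missing `j` classes extends to a reduction of `R ⊕ Id_j`. -/
theorem compRed_join_idN {R S : ℕ → ℕ → Prop} (hS : Equivalence S) {j : ℕ} (hj : 1 ≤ j)
    {f : ℕ → ℕ} (hf : Computable f) (hfr : ∀ x y, R x y ↔ S (f x) (f y)) {c : ℕ → ℕ}
    (hmiss : ∀ s < j, ∀ x, ¬ S (f x) (c s)) (hinj : ∀ s < j, ∀ t < j, S (c s) (c t) → s = t) :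
    CompRed (Join R (IdN j)) S := by
  obtain ⟨c', hc', hcc⟩ := exists_computable_eq_of_lt c j
  let F : ℕ → ℕ := fun x => bif x.bodd then c' (x.div2 % j) else f x.div2
  have hF0 : ∀ a, F (2 * a) = f a := fun a => by simp [F]
  have hF1 : ∀ a, F (2 * a + 1) = c (a % j) := fun a => by
    simp [F, hcc _ (Nat.mod_lt a hj)]
  refine ⟨F, ?_, fun x y => ?_⟩
  · exact computable_parity_cases (f := f) (g := fun x => c' (x % j)) hf
      (hc'.comp (Primrec.nat_mod.to_comp.comp Computable.id (Computable.const j)))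
  · obtain ⟨a, rfl | rfl⟩ := x.even_or_odd' <;> obtain ⟨b, rfl | rfl⟩ := y.even_or_odd' <;>
      simp only [hF0, hF1, join_even_even, join_odd_odd, not_join_even_odd, not_join_odd_even,
        false_iff]
    · exact hfr a b
    · exact hmiss _ (Nat.mod_lt b hj) a
    · exact fun h => hmiss _ (Nat.mod_lt a hj) b (hS.symm h)
    · refine ⟨fun h => ?_, hinj _ (Nat.mod_lt a hj) _ (Nat.mod_lt b hj)⟩
      rw [show a % j = b % j from h]
      exact hS.refl _

theorem stmt_16 (R S : ℕ → ℕ → Prop) (hR : Equivalence R) (hS : Equivalence S)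
    (hsf : SelfFull R) (k : ℕ) (hk : 1 ≤ k)
    (h1 : CompRed R S) (h2 : CompRed S (Join R (IdN k))) :
    EquivC S R ∨ ∃ j, 1 ≤ j ∧ j ≤ k ∧ EquivC S (Join R (IdN j)) := by
  classical
  have hJ : Equivalence (Join R IdEq) := equivalence_join hR eq_equivalence
  have hex : ∃ j, RedBelow S R j := ⟨k, redBelow_of_compRed hk h2⟩
  have hle : Nat.find hex ≤ k := Nat.find_min' hex (redBelow_of_compRed hk h2)
  have hspec := Nat.find_spec hex
  have hmin := fun m => Nat.find_min hex (m := m)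
  generalize Nat.find hex = j at hle hspec hmin
  cases j with
  | zero => exact Or.inl ⟨compRed_of_redBelow_zero hspec, h1⟩
  | succ j =>
    refine Or.inr ⟨j + 1, by omega, hle, compRed_of_redBelow hspec, ?_⟩
    obtain ⟨g, hg, hgr, hb⟩ := hspec
    obtain ⟨f, hf, hfr⟩ := h1
    have honto : ∀ e, (∀ z, e = 2 * z + 1 → z < j + 1) → ∃ x, Join R IdEq (g x) e := by
      intro e he
      by_contra! hmiss
      exact hmin j (by omega) (redBelow_of_not_mem_range hR hg hgr hb he hmiss)
    have hh : ∀ x y, R x y ↔ Join R IdEq (g (f x)) (g (f y)) := fun x y => by rw [hfr, hgr]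
    choose i e hexit hmiss using hsf.exists_exitsAt_not_mem_range hR (hg.comp hf) hh
    have hlift : ∀ s, ∃ c, s < j + 1 → Join R IdEq (g c) (e s) := by
      intro s
      by_cases hs : s < j + 1
      · obtain ⟨c, hc⟩ := honto (e s) fun z hz => by
          have h0 : ExitsAt (fun x => g (f x)) z 0 (e s) := hz
          rwa [← ((hexit s).unique h0).1]
        exact ⟨c, fun _ => hc⟩
      · exact ⟨0, fun h => (hs h).elim⟩
    choose c hc using hlift
    refine compRed_join_idN hS (by omega) hf hfr (c := c) (fun s hs x h => ?_)
      fun s hs t ht h => ?_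
    · exact hmiss s x (hJ.trans ((hgr _ _).1 h) (hc s hs))
    · have hst := hJ.trans (hJ.symm (hc s hs)) (hJ.trans ((hgr _ _).1 h) (hc t ht))
      exact (((hexit s).congr hh hst).unique (hexit t)).1
end

section
/- Let D and E be dark minimal equivalence relations with ¬(D ≤c E) and ¬(E ≤c D). Let A = D ⊕ E and let B be the smallest equivalence relation on ℕ containing D ⊕ E and relating 0 and 1. Then: (i) ¬(A ≤c B) and ¬(B ≤c A); (ii) D ≤c A, E ≤c A, D ≤c B, and E ≤c B; (iii) every dark minimal equivalence relation X with X ≤c A or X ≤c B satisfies X ≡c D or X ≡c E; (iv) there is no equivalence relation Y with Y ≤c A, Y ≤c B, D ≤c Y, and E ≤c Y. -/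
theorem CompRed.trans {R S T : ℕ → ℕ → Prop} (h₁ : CompRed R S) (h₂ : CompRed S T) :
    CompRed R T := by
  obtain ⟨f, hf, hfr⟩ := h₁
  obtain ⟨g, hg, hgr⟩ := h₂
  exact ⟨fun x => g (f x), hg.comp hf, fun x y => (hfr x y).trans (hgr _ _)⟩

/-- Computable self-reductions of a relation without computable transversals are onto classes. -/
theorem selfFull_of_not_compRed_id {R : ℕ → ℕ → Prop} (hR : Equivalence R)
    (hId : ¬ CompRed IdEq R) : SelfFull R := by
  intro f hf hfr a
  by_contra hmiss
  push Not at hmiss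
  apply hId
  have hiter : ∀ n x y, R x y ↔ R (f^[n] x) (f^[n] y) := by
    intro n
    induction n with
    | zero => intro x y; rfl
    | succ n ih =>
      intro x y
      rw [Function.iterate_succ_apply, Function.iterate_succ_apply]
      exact (hfr x y).trans (ih _ _)
  have hne : ∀ i j, i < j → ¬ R (f^[i] a) (f^[j] a) := by
    intro i j hij h
    obtain ⟨d, rfl⟩ : ∃ d, j = i + (d + 1) := ⟨j - i - 1, by omega⟩
    rw [Function.iterate_add_apply, ← hiter, Function.iterate_succ_apply'] at h
    exact hmiss _ (hR.symm h)
  refine ⟨fun n => f^[n] a, ?_, ?_⟩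
  · have : Computable fun n : ℕ => Nat.rec (motive := fun _ => ℕ) a (fun _ y => f y) n :=
      Computable.nat_rec Computable.id (Computable.const a)
        (hf.comp (Computable.snd.comp Computable.snd)).to₂
    refine this.of_eq fun n => ?_
    induction n with
    | zero => rfl
    | succ n ih => rw [Function.iterate_succ_apply', ← ih]
  · intro x y
    refine ⟨fun h => ?_, fun h => ?_⟩
    · cases h; exact hR.refl _
    · rcases lt_trichotomy x y with hlt | heq | hlt
      · exact (hne _ _ hlt h).elim
      · exact heq
      · exact (hne _ _ hlt (hR.symm h)).elim

theorem equivalence_comap {R : ℕ → ℕ → Prop} (hR : Equivalence R) (k : ℕ → ℕ) :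
    Equivalence fun x y => R (k x) (k y) :=
  ⟨fun _ => hR.refl _, fun h => hR.symm h, fun h h' => hR.trans h h'⟩

theorem DarkMinimal.compRed_of_compRed {R S : ℕ → ℕ → Prop} (hS : DarkMinimal S)
    (hR : Equivalence R) (h : CompRed R S) (hinf : (classes R).Infinite) : CompRed S R := by
  by_contra hn
  exact hinf (hS.2 R hR ⟨h, hn⟩)

/-- A computable function meeting infinitely many classes of a dark minimal relation meets all. -/
theorem DarkMinimal.exists_rel {R : ℕ → ℕ → Prop} (hR : Equivalence R) (hmin : DarkMinimal R)
    {k : ℕ → ℕ} (hk : Computable k) (hinf : (classes fun x y => R (k x) (k y)).Infinite) (a : ℕ) :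
    ∃ x, R (k x) a := by
  obtain ⟨r, hr, hrr⟩ :=
    hmin.compRed_of_compRed (equivalence_comap hR k) ⟨k, hk, fun _ _ => Iff.rfl⟩ hinf
  obtain ⟨x, hx⟩ := selfFull_of_not_compRed_id hR hmin.1.2 (fun x => k (r x)) (hk.comp hr) hrr a
  exact ⟨r x, hx⟩

/-- One part of a decidable partition into two pieces is the range of a computable function
meeting infinitely many classes. -/
theorem exists_computable_range {R : ℕ → ℕ → Prop} (hR : Equivalence R)
    (hinf : (classes R).Infinite) {p : ℕ → Bool} (hp : Computable p) :
    ∃ b : Bool, ∃ k : ℕ → ℕ, Computable k ∧ (∀ x, p (k x) = b) ∧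
      (classes fun x y => R (k x) (k y)).Infinite := by
  have hcover : classes R ⊆ ⋃ b : Bool, (fun a => {z | R z a}) '' {x | p x = b} := by
    rintro _ ⟨a, rfl⟩
    exact Set.mem_iUnion.2 ⟨p a, a, rfl, rfl⟩
  obtain ⟨b, hb⟩ : ∃ b : Bool, ((fun a => {z | R z a}) '' {x | p x = b}).Infinite := by
    by_contra! hn
    exact hinf ((Set.finite_iUnion fun b => hn b).subset hcover)
  obtain ⟨c, hc⟩ : ∃ c, p c = b := by
    obtain ⟨_, c, hc, -⟩ := hb.nonempty
    exact ⟨c, hc⟩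
  have hpb : Computable fun x => p x == b := Primrec.beq.to_comp.comp hp (Computable.const b)
  refine ⟨b, fun x => bif p x == b then x else c,
    Computable.cond hpb Computable.id (Computable.const c), ?_, ?_⟩
  · intro x
    by_cases h : p x = b
    · simp [h]
    · simpa [beq_eq_false_iff_ne.2 h] using hc
  · set k : ℕ → ℕ := fun x => bif p x == b then x else c with hk
    intro hfin
    refine hb ((hfin.image fun C => {z | ∃ y ∈ C, R z (k y)}).subset ?_)
    rintro _ ⟨a, ha, rfl⟩
    have hka : k a = a := by simp only [Set.mem_ofPred_eq] at ha; simp [hk, ha]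
    refine ⟨_, ⟨a, rfl⟩, ?_⟩
    ext z
    simp only [Set.mem_ofPred_eq]
    constructor
    · rintro ⟨y, hy, hz⟩
      rw [hka] at hy
      exact hR.trans hz hy
    · intro hz
      exact ⟨a, hR.refl _, by rwa [hka]⟩

/-- If a dark minimal `R` reduces to `C`, and `C` is induced by `S` through `u` on the part where
`p` is false, then either `R` reduces to `S` or the reduction meets infinitely many classes on the
part where `p` is true. -/
theorem DarkMinimal.exists_computable_range {R S C : ℕ → ℕ → Prop} (hR : Equivalence R)
    (hmin : DarkMinimal R) (hRS : ¬ CompRed R S) {p : ℕ → Bool} (hp : Computable p)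
    {u : ℕ → ℕ} (hu : Computable u)
    (hC : ∀ x y, p x = false → p y = false → (C x y ↔ S (u x) (u y)))
    {h : ℕ → ℕ} (hh : Computable h) (hred : ∀ x y, R x y ↔ C (h x) (h y)) :
    ∃ k : ℕ → ℕ, Computable k ∧ (∀ x, p (h (k x)) = true) ∧
      (classes fun x y => R (k x) (k y)).Infinite := by
  obtain ⟨b, k, hk, hkb, hinf⟩ := _root_.exists_computable_range hR hmin.1.1 (hp.comp hh)
  cases b with
  | true => exact ⟨k, hk, hkb, hinf⟩
  | false =>
    refine (hRS ?_).elim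
    have h₁ := hmin.compRed_of_compRed (equivalence_comap hR k) ⟨k, hk, fun _ _ => Iff.rfl⟩ hinf
    refine h₁.trans ⟨fun x => u (h (k x)), hu.comp (hh.comp hk), fun x y => ?_⟩
    exact (hred _ _).trans (hC _ _ (hkb x) (hkb y))

/-- If moreover `C` respects `p`, the reduction stays in the part where `p` is true. -/
theorem DarkMinimal.forall_eq_true {R S C : ℕ → ℕ → Prop} (hR : Equivalence R)
    (hmin : DarkMinimal R) (hRS : ¬ CompRed R S) {p : ℕ → Bool} (hp : Computable p)
    {u : ℕ → ℕ} (hu : Computable u)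
    (hC : ∀ x y, p x = false → p y = false → (C x y ↔ S (u x) (u y)))
    (hCp : ∀ x y, C x y → p x = p y)
    {h : ℕ → ℕ} (hh : Computable h) (hred : ∀ x y, R x y ↔ C (h x) (h y)) (x : ℕ) :
    p (h x) = true := by
  obtain ⟨k, hk, hkp, hinf⟩ := hmin.exists_computable_range hR hRS hp hu hC hh hred
  obtain ⟨y, hy⟩ := hmin.exists_rel hR hk hinf x
  rw [← hCp _ _ ((hred _ _).1 hy), hkp]

/-- If moreover `C` is induced by `R` where `p` is true, the reduction meets every class there. -/
theorem DarkMinimal.exists_eq_true_and_rel {R S C : ℕ → ℕ → Prop} (hR : Equivalence R)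
    (hmin : DarkMinimal R) (hRS : ¬ CompRed R S) {p : ℕ → Bool} (hp : Computable p)
    {u : ℕ → ℕ} (hu : Computable u)
    (hC : ∀ x y, p x = false → p y = false → (C x y ↔ S (u x) (u y)))
    (hC' : ∀ x y, p x = true → p y = true → (C x y ↔ R (u x) (u y)))
    {h : ℕ → ℕ} (hh : Computable h) (hred : ∀ x y, R x y ↔ C (h x) (h y)) (a : ℕ) :
    ∃ x, p (h x) = true ∧ R (u (h x)) a := by
  obtain ⟨k, hk, hkp, hinf⟩ := hmin.exists_computable_range hR hRS hp hu hC hh hred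
  have heq : (fun x y => R (k x) (k y)) = fun x y => R (u (h (k x))) (u (h (k y))) := by
    funext x y
    exact propext ((hred _ _).trans (hC' _ _ (hkp x) (hkp y)))
  rw [heq] at hinf
  obtain ⟨x, hx⟩ := hmin.exists_rel hR (hu.comp (hh.comp hk)) hinf a
  exact ⟨k x, hkp x, hx⟩

theorem DarkMinimal.equivC_of_compRed {R S : ℕ → ℕ → Prop} (hR : Equivalence R)
    (hRmin : DarkMinimal R) (hSmin : DarkMinimal S) (h : CompRed R S) : EquivC R S :=
  ⟨h, hSmin.compRed_of_compRed hR h hRmin.1.1⟩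

/-- A dark minimal relation below something induced by `S` and `T` on two decidable parts is
equivalent to `S` or to `T`, if these are dark minimal. -/
theorem DarkMinimal.equivC_or_equivC {R S T C : ℕ → ℕ → Prop} (hR : Equivalence R)
    (hRmin : DarkMinimal R) (hSmin : DarkMinimal S) (hTmin : DarkMinimal T)
    {p : ℕ → Bool} (hp : Computable p) {u : ℕ → ℕ} (hu : Computable u)
    (hC : ∀ x y, p x = false → p y = false → (C x y ↔ S (u x) (u y)))
    (hC' : ∀ x y, p x = true → p y = true → (C x y ↔ T (u x) (u y)))
    (h : CompRed R C) : EquivC R T ∨ EquivC R S := by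
  by_cases hRS : CompRed R S
  · exact Or.inr (hRmin.equivC_of_compRed hR hSmin hRS)
  obtain ⟨h, hh, hred⟩ := h
  obtain ⟨k, hk, hkp, hinf⟩ := hRmin.exists_computable_range hR hRS hp hu hC hh hred
  refine Or.inl (hRmin.equivC_of_compRed hR hTmin ?_)
  have h₁ := hRmin.compRed_of_compRed (equivalence_comap hR k) ⟨k, hk, fun _ _ => Iff.rfl⟩ hinf
  refine h₁.trans ⟨fun x => u (h (k x)), hu.comp (hh.comp hk), fun x y => ?_⟩
  exact (hred _ _).trans (hC' _ _ (hkp x) (hkp y))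

theorem join_iff (R S : ℕ → ℕ → Prop) (a b : ℕ) :
    Join R S a b ↔ (a % 2 = 0 ∧ b % 2 = 0 ∧ R (a / 2) (b / 2)) ∨
      (a % 2 = 1 ∧ b % 2 = 1 ∧ S (a / 2) (b / 2)) := by
  refine or_congr ⟨?_, ?_⟩ ⟨?_, ?_⟩
  · rintro ⟨x, y, rfl, rfl, h⟩
    refine ⟨by omega, by omega, ?_⟩
    simpa using h
  · rintro ⟨ha, hb, h⟩
    exact ⟨_, _, by omega, by omega, h⟩
  · rintro ⟨x, y, rfl, rfl, h⟩
    refine ⟨by omega, by omega, ?_⟩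
    rwa [show (2 * x + 1) / 2 = x by omega, show (2 * y + 1) / 2 = y by omega]
  · rintro ⟨ha, hb, h⟩
    exact ⟨_, _, by omega, by omega, h⟩

theorem join_equivalence {R S : ℕ → ℕ → Prop} (hR : Equivalence R) (hS : Equivalence S) :
    Equivalence (Join R S) := by
  refine ⟨fun x => ?_, fun {x y} h => ?_, fun {x y z} h h' => ?_⟩
  · rw [join_iff]
    rcases Nat.mod_two_eq_zero_or_one x with hx | hx
    · exact Or.inl ⟨hx, hx, hR.refl _⟩
    · exact Or.inr ⟨hx, hx, hS.refl _⟩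
  · rw [join_iff] at h ⊢
    rcases h with ⟨hx, hy, h⟩ | ⟨hx, hy, h⟩
    · exact Or.inl ⟨hy, hx, hR.symm h⟩
    · exact Or.inr ⟨hy, hx, hS.symm h⟩
  · rw [join_iff] at h h' ⊢
    rcases h with ⟨hx, hy, h⟩ | ⟨hx, hy, h⟩ <;> rcases h' with ⟨hy', hz, h'⟩ | ⟨hy', hz, h'⟩
    · exact Or.inl ⟨hx, hz, hR.trans h h'⟩
    · omega
    · omega
    · exact Or.inr ⟨hx, hz, hS.trans h h'⟩

/-- Collapsing two classes of an equivalence relation gives an equivalence relation. -/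
theorem equivalence_collapse {R : ℕ → ℕ → Prop} (hR : Equivalence R) (a b : ℕ) :
    Equivalence fun x y => R x y ∨ ((R x a ∨ R x b) ∧ (R y a ∨ R y b)) := by
  refine ⟨fun x => Or.inl (hR.refl x), fun {x y} h => ?_, fun {x y z} h h' => ?_⟩
  · exact h.imp (fun h => hR.symm h) And.symm
  · rcases h with h | ⟨hx, hy⟩ <;> rcases h' with h' | ⟨hy', hz⟩
    · exact Or.inl (hR.trans h h')
    · exact Or.inr ⟨hy'.imp (hR.trans h) (hR.trans h), hz⟩
    · exact Or.inr ⟨hx, hy.imp (hR.trans (hR.symm h')) (hR.trans (hR.symm h'))⟩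
    · exact Or.inr ⟨hx, hz⟩

/-- Collapsing the classes of `0` and `1` in a join adds no relation between numbers of the same
parity. -/
theorem join_of_collapse {R S : ℕ → ℕ → Prop} (hR : Equivalence R) (hS : Equivalence S)
    {x y : ℕ} (hxy : x % 2 = y % 2)
    (h : Join R S x y ∨
      ((Join R S x 0 ∨ Join R S x 1) ∧ (Join R S y 0 ∨ Join R S y 1))) : Join R S x y := by
  have hJ := join_equivalence hR hS
  have hpar : ∀ a b, Join R S a b → a % 2 = b % 2 := by
    intro a b hab
    rcases (join_iff _ _ _ _).1 hab with ⟨ha, hb, -⟩ | ⟨ha, hb, -⟩ <;> omega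
  rcases h with h | ⟨hx | hx, hy | hy⟩
  · exact h
  · exact hJ.trans hx (hJ.symm hy)
  · have := hpar _ _ hx; have := hpar _ _ hy; omega
  · have := hpar _ _ hx; have := hpar _ _ hy; omega
  · exact hJ.trans hx (hJ.symm hy)

theorem stmt_19 (D E : ℕ → ℕ → Prop) (hD : Equivalence D) (hE : Equivalence E)
    (hDmin : DarkMinimal D) (hEmin : DarkMinimal E)
    (hDE : ¬ CompRed D E) (hED : ¬ CompRed E D) :
    ∀ B : ℕ → ℕ → Prop, Equivalence B →
      (∀ a b, Join D E a b → B a b) → B 0 1 →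
      (∀ B' : ℕ → ℕ → Prop, Equivalence B' → (∀ a b, Join D E a b → B' a b) → B' 0 1 →
        ∀ a b, B a b → B' a b) →
      (¬ CompRed (Join D E) B ∧ ¬ CompRed B (Join D E)) ∧
      (CompRed D (Join D E) ∧ CompRed E (Join D E) ∧ CompRed D B ∧ CompRed E B) ∧
      (∀ X : ℕ → ℕ → Prop, Equivalence X → DarkMinimal X →
        (CompRed X (Join D E) ∨ CompRed X B) → (EquivC X D ∨ EquivC X E)) ∧
      ¬ ∃ Y : ℕ → ℕ → Prop, Equivalence Y ∧ CompRed Y (Join D E) ∧ CompRed Y B ∧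
        CompRed D Y ∧ CompRed E Y := by
  intro B hB hAB hB01 hBmin
  have hA := join_equivalence hD hE
  have hBA : ∀ x y, x % 2 = y % 2 → (B x y ↔ Join D E x y) := fun x y hxy =>
    ⟨fun h => join_of_collapse hD hE hxy (hBmin _ (equivalence_collapse hA 0 1)
      (fun _ _ => Or.inl) (Or.inr ⟨Or.inl (hA.refl _), Or.inr (hA.refl _)⟩) x y h), hAB x y⟩
  have hu : Computable fun x : ℕ => x / 2 :=
    (Primrec.nat_div.comp Primrec.id (Primrec.const 2)).to_comp
  have hparity : ∀ i, Computable fun x : ℕ => x % 2 == i := fun i =>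
    (Primrec.beq.comp (Primrec.nat_mod.comp Primrec.id (Primrec.const 2))
      (Primrec.const i)).to_comp
  have hdouble : Computable fun x : ℕ => 2 * x :=
    (Primrec.nat_mul.comp (Primrec.const 2) Primrec.id).to_comp
  have hdouble' : Computable fun x : ℕ => 2 * x + 1 := Computable.succ.comp hdouble
  have hA0 : ∀ x y, x % 2 = 0 → y % 2 = 0 → (Join D E x y ↔ D (x / 2) (y / 2)) := by
    intro x y hx hy
    simp [join_iff, hx, hy]
  have hA1 : ∀ x y, x % 2 = 1 → y % 2 = 1 → (Join D E x y ↔ E (x / 2) (y / 2)) := by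
    intro x y hx hy
    simp [join_iff, hx, hy]
  have hB0 : ∀ x y, x % 2 = 0 → y % 2 = 0 → (B x y ↔ D (x / 2) (y / 2)) := fun x y hx hy =>
    (hBA x y (hx.trans hy.symm)).trans (hA0 x y hx hy)
  have hB1 : ∀ x y, x % 2 = 1 → y % 2 = 1 → (B x y ↔ E (x / 2) (y / 2)) := fun x y hx hy =>
    (hBA x y (hx.trans hy.symm)).trans (hA1 x y hx hy)
  have hpar : ∀ x y, Join D E x y → x % 2 = y % 2 := by
    intro x y h
    rcases (join_iff _ _ _ _).1 h with ⟨hx, hy, -⟩ | ⟨hx, hy, -⟩ <;> omega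
  have hDA : CompRed D (Join D E) := ⟨_, hdouble, fun x y => by
    rw [hA0 _ _ (by omega) (by omega)]; simp⟩
  have hEA : CompRed E (Join D E) := ⟨_, hdouble', fun x y => by
    rw [hA1 _ _ (by omega) (by omega), show (2 * x + 1) / 2 = x by omega,
      show (2 * y + 1) / 2 = y by omega]⟩
  have hDB : CompRed D B := ⟨_, hdouble, fun x y => by
    rw [hB0 _ _ (by omega) (by omega)]; simp⟩
  have hEB : CompRed E B := ⟨_, hdouble', fun x y => by
    rw [hB1 _ _ (by omega) (by omega), show (2 * x + 1) / 2 = x by omega,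
      show (2 * y + 1) / 2 = y by omega]⟩
  have ne0 : ∀ x : ℕ, (x % 2 == 0) = false → x % 2 = 1 := fun x h => by
    have := beq_eq_false_iff_ne.1 h; omega
  have ne1 : ∀ x : ℕ, (x % 2 == 1) = false → x % 2 = 0 := fun x h => by
    have := beq_eq_false_iff_ne.1 h; omega
  have hiv : ¬ ∃ Y : ℕ → ℕ → Prop, Equivalence Y ∧ CompRed Y (Join D E) ∧ CompRed Y B ∧
      CompRed D Y ∧ CompRed E Y := by
    rintro ⟨Y, -, ⟨f, hf, hfr⟩, ⟨g, hg, hgr⟩, ⟨d, hd, hdr⟩, ⟨e, he, her⟩⟩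
    have hfd := hDmin.forall_eq_true hD hDE (hparity 0) hu
      (fun x y hx hy => hA1 x y (ne0 x hx) (ne0 y hy)) (fun x y h => by rw [hpar x y h])
      (hf.comp hd) (fun x y => (hdr x y).trans (hfr _ _))
    have hfe := hEmin.forall_eq_true hE hED (hparity 1) hu
      (fun x y hx hy => hA0 x y (ne1 x hx) (ne1 y hy)) (fun x y h => by rw [hpar x y h])
      (hf.comp he) (fun x y => (her x y).trans (hfr _ _))
    obtain ⟨x, hx, hx0⟩ := hDmin.exists_eq_true_and_rel hD hDE (hparity 0) hu
      (fun x y hx hy => hB1 x y (ne0 x hx) (ne0 y hy))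
      (fun x y hx hy => hB0 x y (beq_iff_eq.1 hx) (beq_iff_eq.1 hy))
      (hg.comp hd) (fun x y => (hdr x y).trans (hgr _ _)) 0
    obtain ⟨y, hy, hy0⟩ := hEmin.exists_eq_true_and_rel hE hED (hparity 1) hu
      (fun x y hx hy => hB0 x y (ne1 x hx) (ne1 y hy))
      (fun x y hx hy => hB1 x y (beq_iff_eq.1 hx) (beq_iff_eq.1 hy))
      (hg.comp he) (fun x y => (her x y).trans (hgr _ _)) 0
    have hgx : B (g (d x)) 0 := (hB0 _ _ (beq_iff_eq.1 hx) rfl).2 hx0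
    have hgy : B (g (e y)) 1 := (hB1 _ _ (beq_iff_eq.1 hy) rfl).2 hy0
    have hxy : Y (d x) (e y) := (hgr _ _).2 (hB.trans hgx (hB.trans hB01 (hB.symm hgy)))
    have h₁ := hpar _ _ ((hfr _ _).1 hxy)
    have h₂ := beq_iff_eq.1 (hfd x)
    have h₃ := beq_iff_eq.1 (hfe y)
    omega
  have hrefl : ∀ R : ℕ → ℕ → Prop, CompRed R R := fun R =>
    ⟨id, Computable.id, fun _ _ => Iff.rfl⟩
  refine ⟨⟨fun h => hiv ⟨_, hA, hrefl _, h, hDA, hEA⟩, fun h => hiv ⟨_, hB, h, hrefl _, hDB, hEB⟩⟩,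
    ⟨hDA, hEA, hDB, hEB⟩, ?_, hiv⟩
  rintro X hX hXmin (h | h)
  · exact hXmin.equivC_or_equivC hX hEmin hDmin (hparity 0) hu
      (fun x y hx hy => hA1 x y (ne0 x hx) (ne0 y hy))
      (fun x y hx hy => hA0 x y (beq_iff_eq.1 hx) (beq_iff_eq.1 hy)) h
  · exact hXmin.equivC_or_equivC hX hEmin hDmin (hparity 0) hu
      (fun x y hx hy => hB1 x y (ne0 x hx) (ne0 y hy))
      (fun x y hx hy => hB0 x y (beq_iff_eq.1 hx) (beq_iff_eq.1 hy)) h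
end
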